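/- arXiv:1304.7152 — 6 statements merged into one kernel-verified Lean document; each statement's English description precedes it below -/
import Mathlib

section
/- Let p be a prime, n ≥ 1, k ≥ 1, and let D be the (ZMod p)-linear derivation of MvPolynomial (Fin n) (ZMod p) determined by D(x_i) = x_i^{p^k} for every variable x_i. Then the p-fold composite of D (as a (ZMod p)-linear endomorphism) is zero: D^p = 0. (Thus each Margolis differential d_k defines a p-differential graded structure on the polynomial ring, as asserted for the standard family of p-differentials in Theorem 4.7.) -/
open MvPolynomial

/-- The Leibniz rule for iterates of a derivation. -/
theorem Derivation.toLinearMap_pow_apply_mul {R A : Type*} [CommSemiring R] [CommSemiring A]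
    [Algebra R A] (D : Derivation R A A) (m : ℕ) (a b : A) :
    (D.toLinearMap ^ m) (a * b) = ∑ ij ∈ Finset.HasAntidiagonal.antidiagonal m,
      m.choose ij.1 • ((D.toLinearMap ^ ij.1) a * (D.toLinearMap ^ ij.2) b) := by
  induction m with
  | zero => simp
  | succ m ih =>
    rw [Finset.sum_antidiagonal_choose_succ_nsmul
      (fun i j => (D.toLinearMap ^ i) a * (D.toLinearMap ^ j) b) m, pow_succ', Module.End.mul_apply,
      ih, map_sum, ← Finset.sum_add_distrib]
    refine Finset.sum_congr rfl fun ij hij => ?_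
    rw [← Nat.choose_symm_of_eq_add (Finset.HasAntidiagonal.mem_antidiagonal.mp hij).symm]
    simp only [pow_succ', Module.End.mul_apply, map_nsmul, Derivation.coeFn_coe,
      Derivation.leibniz, smul_eq_mul, smul_add]
    ring

/-- In characteristic `p`, the `p`-th iterate of a derivation satisfies the Leibniz rule. -/
theorem Derivation.toLinearMap_pow_char_apply_mul {R A : Type*} [CommSemiring R] [CommSemiring A]
    [Algebra R A] (p : ℕ) [hp : Fact p.Prime] [CharP A p] (D : Derivation R A A) (a b : A) :
    (D.toLinearMap ^ p) (a * b) = a * (D.toLinearMap ^ p) b + (D.toLinearMap ^ p) a * b := by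
  have hne : (0, p) ≠ (p, 0) := by simp [hp.out.ne_zero]
  rw [D.toLinearMap_pow_apply_mul, Finset.sum_eq_add_of_mem (0, p) (p, 0) (by simp) (by simp) hne]
  · simp
  · rintro ⟨i, j⟩ hij ⟨h0, h1⟩
    rw [Finset.HasAntidiagonal.mem_antidiagonal] at hij
    have hi : i ≠ 0 := by rintro rfl; simp_all
    have hip : i < p := by
      refine lt_of_le_of_ne (by simp at hij; omega) ?_
      rintro rfl
      simp_all
    rw [nsmul_eq_mul, (CharP.cast_eq_zero_iff A p _).mpr (hp.out.dvd_choose_self hi hip), zero_mul]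

/-- The `k`-th Margolis differential `d_k` on the polynomial ring `𝔽_p[x_1, …, x_n]`
(the `ZMod p`-linear derivation with `d_k x_i = x_i^{p^k}`) satisfies `d_k^p = 0`,
i.e. it defines a `p`-differential graded structure. -/
theorem margolis_pow_p_eq_zero (p n k : ℕ) [Fact p.Prime] (hn : 1 ≤ n) (hk : 1 ≤ k) :
    (mkDerivation (ZMod p) fun i : Fin n => X i ^ p ^ k :
        Derivation (ZMod p) (MvPolynomial (Fin n) (ZMod p))
          (MvPolynomial (Fin n) (ZMod p))).toLinearMap ^ p = 0 := by
  set D : Derivation (ZMod p) (MvPolynomial (Fin n) (ZMod p)) (MvPolynomial (Fin n) (ZMod p)) :=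
    mkDerivation (ZMod p) fun i : Fin n => X i ^ p ^ k with hD
  have hp : 2 ≤ p := (Fact.out : p.Prime).two_le
  have hX (i : Fin n) : (D.toLinearMap ^ p) (X i) = 0 := by
    have hDD : (D.toLinearMap ^ 2) (X i) = 0 := by
      have hq : ((p ^ k : ℕ) : MvPolynomial (Fin n) (ZMod p)) = 0 :=
        (CharP.cast_eq_zero_iff _ p _).mpr (dvd_pow_self p (by omega))
      rw [pow_two, Module.End.mul_apply, Derivation.coeFn_coe, hD, mkDerivation_X,
        Derivation.leibniz_pow, ← Nat.cast_smul_eq_nsmul (MvPolynomial (Fin n) (ZMod p)), hq,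
        zero_smul]
    exact Module.End.pow_map_zero_of_le hp hDD
  have hC (c : ZMod p) : (D.toLinearMap ^ p) (C c) = 0 :=
    Module.End.pow_map_zero_of_le (one_le_two.trans hp) (by simp)
  refine LinearMap.ext fun f => ?_
  induction f using MvPolynomial.induction_on with
  | C c => exact hC c
  | add f g hf hg => rw [map_add, hf, hg, map_add]
  | mul_X f i hf => simp [D.toLinearMap_pow_char_apply_mul p, hX, hf]
end

section
/- Let p be a prime and n ≥ 1, and let ∂ be the (ZMod p)-linear derivation of MvPolynomial (Fin n) (ZMod p) determined by ∂(x_i) = x_i^2 for every variable x_i. Then the p-fold composite of ∂ (as a (ZMod p)-linear endomorphism) is zero: ∂^p = 0. (This is the p-DG structure of Khovanov–Qi on the polynomial ring: ∂ satisfies ∂^p = 0 and the Leibniz rule.) -/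
open MvPolynomial

/-- In characteristic `p`, the `p`-th power of a derivation satisfies the Leibniz rule. -/
theorem Derivation.pow_char_apply_mul {R A : Type*} [CommRing R] [CommRing A] [Algebra R A]
    (p : ℕ) [Fact p.Prime] [CharP A p] (D : Derivation R A A) (a b : A) :
    (D.toLinearMap ^ p) (a * b) =
      (D.toLinearMap ^ p) a * b + a * (D.toLinearMap ^ p) b := by
  set d : Module.End R A := D.toLinearMap
  set l : Module.End R (TensorProduct R A A) := d.rTensor A
  set r : Module.End R (TensorProduct R A A) := d.lTensor A
  have hcomm : Commute l r :=
    (LinearMap.rTensor_comp_lTensor _ d d).trans (LinearMap.lTensor_comp_rTensor _ d d).symm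
  have hmul : d ∘ₗ LinearMap.mul' R A = LinearMap.mul' R A ∘ₗ (l + r) := by
    ext x y
    simp [d, l, r, mul_comm, add_comm]
  have hpow : ∀ (k : ℕ) (t : TensorProduct R A A),
      (d ^ k) (LinearMap.mul' R A t) = LinearMap.mul' R A (((l + r) ^ k) t) := by
    intro k
    induction k with
    | zero => simp
    | succ k ih =>
      intro t
      rw [pow_succ, pow_succ, Module.End.mul_apply, Module.End.mul_apply, ← ih]
      exact congrArg (d ^ k) (LinearMap.congr_fun hmul t)
  obtain ⟨s, hs⟩ := hcomm.exists_add_pow_prime_eq (Fact.out : p.Prime)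
  have h := hpow p (a ⊗ₜ[R] b)
  have hzero (t : TensorProduct R A A) : LinearMap.mul' R A (p * t) = 0 := by
    rw [← nsmul_eq_mul, map_nsmul, nsmul_eq_mul, CharP.cast_eq_zero, zero_mul]
  rw [hs] at h
  simpa [l, r, LinearMap.rTensor_pow, LinearMap.lTensor_pow, hzero] using h

theorem Derivation.pow_apply_of_apply_eq_sq {R A : Type*} [CommRing R] [CommRing A] [Algebra R A]
    (D : Derivation R A A) {x : A} (hx : D x = x ^ 2) (k : ℕ) :
    (D.toLinearMap ^ k) x = (k.factorial : A) * x ^ (k + 1) := by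
  induction k with
  | zero => simp
  | succ k ih =>
    rw [pow_succ', Module.End.mul_apply, ih]
    simp only [Derivation.coeFn_coe, Derivation.leibniz, Derivation.leibniz_pow,
      Derivation.map_natCast, hx, Nat.factorial_succ, smul_eq_mul, nsmul_eq_mul]
    push_cast
    ring

/-- The Khovanov–Qi differential `∂` on the polynomial ring `𝔽_p[x_1, …, x_n]`
(the `ZMod p`-linear derivation with `∂ x_i = x_i^2`) satisfies `∂^p = 0`,
i.e. it defines a `p`-differential graded structure. -/
theorem khovanovQi_pow_p_eq_zero (p n : ℕ) [Fact p.Prime] (hn : 1 ≤ n) :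
    (mkDerivation (ZMod p) fun i : Fin n => X i ^ 2 :
        Derivation (ZMod p) (MvPolynomial (Fin n) (ZMod p))
          (MvPolynomial (Fin n) (ZMod p))).toLinearMap ^ p = 0 := by
  have hp : p.Prime := Fact.out
  refine LinearMap.ext fun f => ?_
  rw [LinearMap.zero_apply]
  induction f using MvPolynomial.induction_on with
  | C a =>
    rw [← pow_sub_one_mul hp.ne_zero, Module.End.mul_apply, Derivation.coeFn_coe, derivation_C,
      map_zero]
  | add f g hf hg => rw [map_add, hf, hg, add_zero]
  | mul_X f i hf =>
    rw [Derivation.pow_char_apply_mul, hf,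
      Derivation.pow_apply_of_apply_eq_sq _ (mkDerivation_X _ _ i),
      (CharP.cast_eq_zero_iff _ p _).2 (hp.dvd_factorial.2 le_rfl)]
    simp
end

section
/- Let p be a prime, n ≥ 1, and let ∂ be the (ZMod p)-linear derivation of MvPolynomial (Fin n) (ZMod p) determined by ∂(x_j) = x_j^2 for every variable x_j. Let e_i denote the i-th elementary symmetric polynomial in x_1, …, x_n. Then ∂(e_i) = e_1·e_i − (i+1)·e_{i+1} for 1 ≤ i < n, and ∂(e_n) = e_1·e_n. (These are the formulas (5.3) for the induced p-DG structure on the subalgebra of symmetric polynomials.) -/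
open MvPolynomial

section SquareDerivation

variable {σ R : Type*} [CommRing R]

/-- The derivation `X j ↦ X j ^ 2` multiplies a squarefree monomial by the sum of its variables. -/
lemma mkDerivation_sq_prod_X (s : Finset σ) :
    (mkDerivation R fun j : σ => (X j ^ 2 : MvPolynomial σ R)) (∏ j ∈ s, X j) =
      (∑ j ∈ s, X j) * ∏ j ∈ s, X j := by
  classical
  induction s using Finset.induction_on with
  | empty => simp
  | insert a s ha ih =>
    rw [Finset.prod_insert ha, Finset.sum_insert ha, Derivation.leibniz, ih, mkDerivation_X]
    simp only [smul_eq_mul]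
    ring

/-- Each squarefree monomial of degree `k + 1` arises in `k + 1` ways as a variable times a
squarefree monomial of degree `k` not containing it. -/
lemma sum_powersetCard_sum_compl_X_mul_prod [Fintype σ] [DecidableEq σ] (k : ℕ) :
    ∑ s ∈ Finset.powersetCard k (Finset.univ : Finset σ),
        ∑ j ∈ sᶜ, (X j * ∏ i ∈ s, X i : MvPolynomial σ R) =
      C ((k + 1 : ℕ) : R) * esymm σ R (k + 1) := by
  have h : ∀ t ∈ Finset.powersetCard (k + 1) (Finset.univ : Finset σ),
      C ((k + 1 : ℕ) : R) * ∏ i ∈ t, X i = ∑ _j ∈ t, ∏ i ∈ t, (X i : MvPolynomial σ R) := by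
    intro t ht
    rw [Finset.sum_const, (Finset.mem_powersetCard.1 ht).2, nsmul_eq_mul, map_natCast]
  rw [esymm, Finset.mul_sum, Finset.sum_congr rfl h, Finset.sum_sigma', Finset.sum_sigma']
  refine Finset.sum_bij' (fun a _ => ⟨insert a.2 a.1, a.2⟩) (fun a _ => ⟨a.1.erase a.2, a.2⟩)
    ?_ ?_ ?_ ?_ ?_
  · rintro ⟨s, j⟩ hs
    simp only [Finset.mem_sigma, Finset.mem_powersetCard_univ, Finset.mem_compl] at hs ⊢
    simp [Finset.card_insert_of_notMem hs.2, hs.1]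
  · rintro ⟨t, j⟩ ht
    simp only [Finset.mem_sigma, Finset.mem_powersetCard_univ, Finset.mem_compl] at ht ⊢
    simp [Finset.card_erase_of_mem ht.2, ht.1]
  · rintro ⟨s, j⟩ hs
    simp only [Finset.mem_sigma, Finset.mem_compl] at hs
    simp [Finset.erase_insert hs.2]
  · rintro ⟨t, j⟩ ht
    simp only [Finset.mem_sigma] at ht
    simp [Finset.insert_erase ht.2]
  · rintro ⟨s, j⟩ hs
    simp only [Finset.mem_sigma, Finset.mem_compl] at hs
    simp [Finset.prod_insert hs.2]

lemma mkDerivation_sq_esymm [Fintype σ] (k : ℕ) :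
    (mkDerivation R fun j : σ => (X j ^ 2 : MvPolynomial σ R)) (esymm σ R k) =
      esymm σ R 1 * esymm σ R k - C ((k + 1 : ℕ) : R) * esymm σ R (k + 1) := by
  classical
  rw [← sum_powersetCard_sum_compl_X_mul_prod, eq_sub_iff_add_eq, esymm_one, esymm, map_sum,
    Finset.mul_sum, ← Finset.sum_add_distrib]
  refine Finset.sum_congr rfl fun s _ => ?_
  rw [mkDerivation_sq_prod_X, ← Finset.sum_mul, ← add_mul, Finset.sum_add_sum_compl]

end SquareDerivation

/-- The Khovanov–Qi differential `∂` (the derivation with `∂ x_j = x_j^2`) acts on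
elementary symmetric polynomials by `∂ e_i = e_1 e_i - (i+1) e_{i+1}` for `1 ≤ i < n`
and `∂ e_n = e_1 e_n`. -/
theorem khovanovQi_esymm (p n : ℕ) [Fact p.Prime] (hn : 1 ≤ n) :
    (∀ i : ℕ, 1 ≤ i → i < n →
      (mkDerivation (ZMod p) fun j : Fin n => X j ^ 2) (esymm (Fin n) (ZMod p) i) =
        esymm (Fin n) (ZMod p) 1 * esymm (Fin n) (ZMod p) i -
          C ((i + 1 : ℕ) : ZMod p) * esymm (Fin n) (ZMod p) (i + 1)) ∧
    (mkDerivation (ZMod p) fun j : Fin n => X j ^ 2) (esymm (Fin n) (ZMod p) n) =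
      esymm (Fin n) (ZMod p) 1 * esymm (Fin n) (ZMod p) n := by
  refine ⟨fun i _ _ => mkDerivation_sq_esymm i, ?_⟩
  have h : esymm (Fin n) (ZMod p) (n + 1) = 0 := by
    rw [esymm, Finset.powersetCard_eq_empty.2 (by simp), Finset.sum_empty]
  rw [mkDerivation_sq_esymm, h, mul_zero, sub_zero]
end

section
/- Let p be a prime and let D be the (ZMod p)-linear derivation of R = MvPolynomial (Fin 2) (ZMod p) determined by D(X) = X^2 and D(Y) = Y^2 (the Khovanov–Qi differential). Then for all f, g, h ∈ R with (X−Y)·g = f − σ(f) and (X−Y)·h = D(f) − σ(D(f)), one has h − D(g) = (X + Y)·g. (This encodes the Khovanov–Qi formula ∂(δ_i) = (x_i + x_{i+1})·δ_i for the action of the differential on the divided difference generators of the nilHecke algebra: the commutator of ∂ with the divided difference operator equals multiplication by (X+Y) followed by the divided difference operator.) -/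
open MvPolynomial

/-- The algebra automorphism `σ` of `𝔽_p[X,Y]` exchanging the two variables. -/
noncomputable def swapVars (p : ℕ) :
    MvPolynomial (Fin 2) (ZMod p) →ₐ[ZMod p] MvPolynomial (Fin 2) (ZMod p) :=
  rename (Equiv.swap (0 : Fin 2) 1)

/-- The Khovanov–Qi differential on `𝔽_p[X,Y]`: the `ZMod p`-linear derivation with
`D X = X^2` and `D Y = Y^2`. -/
noncomputable def kqDiff (p : ℕ) :
    Derivation (ZMod p) (MvPolynomial (Fin 2) (ZMod p)) (MvPolynomial (Fin 2) (ZMod p)) :=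
  mkDerivation (ZMod p) fun i => X i ^ 2

/-- The Khovanov–Qi differential commutes with the exchange of the variables. -/
theorem kqDiff_swapVars (p : ℕ) (f : MvPolynomial (Fin 2) (ZMod p)) :
    kqDiff p (swapVars p f) = swapVars p (kqDiff p f) := by
  induction f using MvPolynomial.induction_on with
  | C a => simp [swapVars, kqDiff]
  | add f g hf hg => simp only [map_add, hf, hg]
  | mul_X f i hf =>
    have hX : kqDiff p (swapVars p (X i)) = swapVars p (kqDiff p (X i)) := by
      simp [swapVars, kqDiff, mkDerivation_X]
    simp only [map_mul, Derivation.leibniz, smul_eq_mul, map_add, hf, hX]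

/-- The Khovanov–Qi formula `∂ δ = (x_i + x_{i+1}) δ`: if `(X - Y) g = f - σ f` and
`(X - Y) h = D f - σ (D f)` (so `g = ∂ f` and `h = ∂ (D f)`), then
`h - D g = (X + Y) g`. -/
theorem khovanovQi_divided_difference (p : ℕ) [Fact p.Prime]
    (f g h : MvPolynomial (Fin 2) (ZMod p))
    (hg : (X 0 - X 1) * g = f - swapVars p f)
    (hh : (X 0 - X 1) * h = kqDiff p f - swapVars p (kqDiff p f)) :
    h - kqDiff p g = (X 0 + X 1) * g := by
  have hXY : (X 0 - X 1 : MvPolynomial (Fin 2) (ZMod p)) ≠ 0 :=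
    sub_ne_zero.2 fun e => zero_ne_one (X_injective e)
  have hD := congrArg (kqDiff p) hg
  rw [Derivation.leibniz, map_sub, map_sub, kqDiff_swapVars, ← hh] at hD
  simp only [kqDiff, mkDerivation_X, smul_eq_mul] at hD ⊢
  apply mul_left_cancel₀ hXY
  linear_combination -hD
end

section
/- Let p be a prime, a ≥ 0 a natural number, and let D be the (ZMod p)-linear derivation of R = MvPolynomial (Fin 2) (ZMod p) determined by D(X) = X^2 and D(Y) = Y^2. For u ∈ R set v = a·Y·u + D(u) (coefficients taken in ZMod p). Then for all u, h, w ∈ R with (X−Y)·h = u − σ(u) and (X−Y)·w = v − σ(v), one has Y^a·w − D(Y^a·h) = Y^a·( −a·u + ((a+1)·X − (a−1)·Y)·h ). (This encodes the twisted p-DG structure of Khovanov–Qi on the nilHecke algebra arising from the ideal ⟨Y^a⟩ ⊂ R: up to the paper's sign conventions it is the formula ∂_a(δ_i) = a + (a+1)x_i δ_i + (a−1)x_{i+1} δ_i, where δ_i acts on the twisted module through f ↦ Y^a ∂(Y^{−a} f).) -/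
open MvPolynomial

theorem swapVars_X_zero (p : ℕ) : swapVars p (X 0) = X 1 := by
  simp [swapVars]

theorem swapVars_X_one (p : ℕ) : swapVars p (X 1) = X 0 := by
  simp [swapVars]

theorem kqDiff_X (p : ℕ) (i : Fin 2) : kqDiff p (X i) = X i ^ 2 := by
  simp [kqDiff, mkDerivation_X]

theorem kqDiff_X_pow (p : ℕ) (i : Fin 2) (n : ℕ) :
    kqDiff p (X i ^ n) = C (n : ZMod p) * X i ^ (n + 1) := by
  induction n with
  | zero => simp
  | succ n ih =>
    rw [pow_succ, Derivation.leibniz, ih, kqDiff_X]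
    simp only [smul_eq_mul, Nat.cast_add, Nat.cast_one, map_add, map_one]
    ring

/-- The twisted Khovanov–Qi structure coming from the ideal `⟨Y^a⟩`: with
`v = a·Y·u + D u`, if `(X - Y) h = u - σ u` (so `h = ∂ u`) and `(X - Y) w = v - σ v`
(so `w = ∂ v`), then
`Y^a w - D (Y^a h) = Y^a (-a·u + ((a+1)X - (a-1)Y) h)`,
encoding `∂_a δ = a + ((a+1) x_i + (a-1) x_{i+1}) δ` up to the paper's signs. -/
theorem khovanovQi_twisted_divided_difference (p a : ℕ) [Fact p.Prime]
    (u h w : MvPolynomial (Fin 2) (ZMod p))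
    (hu : (X 0 - X 1) * h = u - swapVars p u)
    (hw : (X 0 - X 1) * w =
      (C (a : ZMod p) * (X 1 * u) + kqDiff p u) -
        swapVars p (C (a : ZMod p) * (X 1 * u) + kqDiff p u)) :
    X 1 ^ a * w - kqDiff p (X 1 ^ a * h) =
      X 1 ^ a * (-(C (a : ZMod p)) * u +
        (C ((a : ZMod p) + 1) * X 0 - C ((a : ZMod p) - 1) * X 1) * h) := by
  have hD := congrArg (kqDiff p) hu
  simp only [Derivation.leibniz, map_sub, smul_eq_mul, kqDiff_X, kqDiff_swapVars] at hD
  simp only [map_add, map_mul, swapVars_X_one] at hw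
  rw [show swapVars p (C (a : ZMod p)) = C (a : ZMod p) from rename_C _ _] at hw
  have hXY : (X 0 - X 1 : MvPolynomial (Fin 2) (ZMod p)) ≠ 0 :=
    sub_ne_zero.2 fun h => zero_ne_one (X_injective h)
  have hw' : w = -(C (a : ZMod p)) * u + C (a : ZMod p) * X 0 * h + (X 0 + X 1) * h
      + kqDiff p h := by
    apply mul_left_cancel₀ hXY
    linear_combination hw - hD - C (a : ZMod p) * X 0 * hu
  rw [hw', Derivation.leibniz, kqDiff_X_pow]
  simp only [smul_eq_mul, map_add, map_sub, map_one]
  ring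
end

section
/- Let p be a prime, n ≥ 1, and let Φ be the (ZMod p)-algebra endomorphism of MvPolynomial (Fin n) (ZMod p) determined by Φ(x_i) = x_i·(1 + x_i)^{p−1} for every variable x_i (the total operation of the Steenrod structure with P^k x = binom(p−1, k) x^{k+1}). Let p_m = ∑_{i=1}^{n} x_i^m denote the m-th power sum. Then for all k ≥ 1 and d ≥ 0, the homogeneous component of degree k + d of Φ(p_k) equals binom(k(p−1), d) · p_{k+d}, with the binomial coefficient taken in ZMod p; in particular this component vanishes for d > k(p−1). (This is the formula P^d p_k = binom(k(p−1), d) p_{d+k} used in the proof of Theorem 5.5 to show that the subalgebra of symmetric polynomials is closed under the twisted Steenrod action.) -/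
open MvPolynomial

/-- The total operation of the twisted Steenrod structure `P^k x = C(p-1,k) x^{k+1}`:
the algebra endomorphism `Φ` of `𝔽_p[x_1, …, x_n]` with `Φ x_i = x_i (1 + x_i)^{p-1}`. -/
noncomputable def twistedTotal (p n : ℕ) :
    MvPolynomial (Fin n) (ZMod p) →ₐ[ZMod p] MvPolynomial (Fin n) (ZMod p) :=
  aeval fun i => X i * (1 + X i) ^ (p - 1)

/-- The degree `k + d` part of `x^k (1 + x)^N` is `C(N, d) x^{k+d}`. -/
theorem homogeneousComponent_X_pow_mul_one_add_X_pow {σ R : Type*} [CommSemiring R]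
    (i : σ) (k N d : ℕ) :
    homogeneousComponent (k + d) (X i ^ k * (1 + X i) ^ N : MvPolynomial σ R) =
      C (N.choose d : R) * X i ^ (k + d) := by
  have expand : (X i ^ k * (1 + X i) ^ N : MvPolynomial σ R) =
      ∑ m ∈ Finset.range (N + 1), C (N.choose m : R) * X i ^ (k + m) := by
    rw [add_comm, add_pow, Finset.mul_sum]
    refine Finset.sum_congr rfl fun m _ => ?_
    rw [map_natCast, one_pow, pow_add]
    ring
  have component (m : ℕ) : homogeneousComponent (k + d) (X i ^ (k + m) : MvPolynomial σ R) =
      if d = m then X i ^ (k + m) else 0 := by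
    rw [homogeneousComponent_of_mem ((mem_homogeneousSubmodule _ _).2 (isHomogeneous_X_pow i _))]
    simp only [Nat.add_left_cancel_iff]
  simp only [expand, map_sum, homogeneousComponent_C_mul, component, mul_ite, mul_zero,
    Finset.sum_ite_eq, Finset.mem_range]
  split_ifs with h
  · rfl
  · rw [Nat.choose_eq_zero_of_lt (by omega), Nat.cast_zero, C_0, zero_mul]

/-- `P^d p_k = C(k(p-1), d) p_{k+d}` for power sums: the degree `k + d` homogeneous
component of `Φ(p_k)` is `C(k(p-1), d) p_{k+d}` (and in particular vanishes for
`d > k(p-1)`). -/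
theorem twistedSteenrod_psum (p n : ℕ) [Fact p.Prime] (hn : 1 ≤ n) (k d : ℕ)
    (hk : 1 ≤ k) :
    homogeneousComponent (k + d) (twistedTotal p n (psum (Fin n) (ZMod p) k)) =
      C ((Nat.choose (k * (p - 1)) d : ZMod p)) * psum (Fin n) (ZMod p) (k + d) := by
  simp only [twistedTotal, psum, map_sum, map_pow, aeval_X, mul_pow, ← pow_mul,
    homogeneousComponent_X_pow_mul_one_add_X_pow, Finset.mul_sum, mul_comm (p - 1) k]
end
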